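/- In any routing game with continuous, nonnegative, nondecreasing edge costs, edges inactive at a demand μ₀ remain inactive at all nearby demands: for every μ₀ > 0 there exists ε > 0 such that Ẽ(μ) ⊆ Ẽ(μ₀) for all μ ∈ (μ₀−ε, μ₀+ε) ∩ (0,∞). -/

import Mathlib

open Finset Set

noncomputable section

variable {E P : Type*}

/-- The load induced on edge `e` by a path-flow `f`. -/
def edgeLoad [Fintype P] [DecidableEq E] (path : P → Finset E) (f : P → ℝ) (e : E) : ℝ :=
  ∑ p, if e ∈ path p then f p else 0

/-- A flow is feasible for demand `μ` if it is nonnegative and routes total demand `μ`. -/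
def Feasible [Fintype P] (f : P → ℝ) (μ : ℝ) : Prop :=
  (∀ p, 0 ≤ f p) ∧ ∑ p, f p = μ

/-- The cost of path `p` under flow `f`. -/
def pathCost [Fintype P] [DecidableEq E] (path : P → Finset E) (c : E → ℝ → ℝ)
    (f : P → ℝ) (p : P) : ℝ :=
  ∑ e ∈ path p, c e (edgeLoad path f e)

/-- Wardrop equilibrium with equilibrium cost `lam` at demand `μ`. -/
def IsWardrop [Fintype P] [DecidableEq E] (path : P → Finset E) (c : E → ℝ → ℝ)
    (μ : ℝ) (f : P → ℝ) (lam : ℝ) : Prop :=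
  Feasible f μ ∧ (∀ p, 0 < f p → pathCost path c f p = lam) ∧
    ∀ p, lam ≤ pathCost path c f p

/-- Social cost of a flow. -/
def socialCost [Fintype E] [Fintype P] [DecidableEq E] (path : P → Finset E)
    (c : E → ℝ → ℝ) (f : P → ℝ) : ℝ :=
  ∑ e, edgeLoad path f e * c e (edgeLoad path f e)

/-- The active network: edges lying on some path of cost `lam` (the minimal cost). -/
def activeNet [Fintype P] [DecidableEq E] (path : P → Finset E) (c : E → ℝ → ℝ)
    (f : P → ℝ) (lam : ℝ) : Set E :=
  {e | ∃ p, pathCost path c f p = lam ∧ e ∈ path p}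

/-- `μ₀` is a breakpoint of the active-network map `Act`. -/
def IsBreakpoint (Act : ℝ → Set E) (μ₀ : ℝ) : Prop :=
  0 < μ₀ ∧ ∃ ε > 0,
    (∀ μ ∈ Set.Ico (μ₀ - ε) μ₀, Act μ = Act (μ₀ - ε)) ∧
    (∀ μ ∈ Set.Ioc μ₀ (μ₀ + ε), Act μ = Act (μ₀ + ε)) ∧
    Act (μ₀ - ε) ≠ Act (μ₀ + ε)

/-- Summing path costs against a path-flow equals summing edge costs against its edge loads. -/
lemma sum_mul_pathCost [Fintype E] [DecidableEq E] [Fintype P] (path : P → Finset E)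
    (c : E → ℝ → ℝ) (f g : P → ℝ) :
    ∑ p, g p * pathCost path c f p = ∑ e, edgeLoad path g e * c e (edgeLoad path f e) := by
  have hpc (p : P) : g p * pathCost path c f p =
      ∑ e, (if e ∈ path p then g p else 0) * c e (edgeLoad path f e) := by
    simp [pathCost, Finset.mul_sum, ite_mul, Finset.sum_ite_mem]
  simp_rw [hpc, edgeLoad, Finset.sum_mul]
  exact Finset.sum_comm

lemma edgeLoad_le [DecidableEq E] [Fintype P] (path : P → Finset E) {f : P → ℝ} {μ : ℝ}
    (hf : Feasible f μ) (e : E) : edgeLoad path f e ≤ μ := by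
  rw [← hf.2, edgeLoad]
  refine Finset.sum_le_sum fun p _ => ?_
  split_ifs
  exacts [le_rfl, hf.1 p]

namespace IsWardrop

variable [DecidableEq E] [Fintype P] {path : P → Finset E} {c : E → ℝ → ℝ}
  {μ ν lam lam' : ℝ} {f g : P → ℝ}

lemma sum_mul_pathCost_self (h : IsWardrop path c μ f lam) :
    ∑ p, f p * pathCost path c f p = μ * lam := by
  rw [← h.1.2, Finset.sum_mul]
  refine Finset.sum_congr rfl fun p _ => ?_
  rcases (h.1.1 p).eq_or_lt with h0 | h0
  · simp [← h0]
  · rw [h.2.1 p h0]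

lemma mul_le_sum_mul_pathCost (h : IsWardrop path c μ f lam) (hg : Feasible g ν) :
    ν * lam ≤ ∑ p, g p * pathCost path c f p := by
  rw [← hg.2, Finset.sum_mul]
  exact Finset.sum_le_sum fun p _ => mul_le_mul_of_nonneg_left (h.2.2 p) (hg.1 p)

lemma exists_pathCost_eq (h : IsWardrop path c μ f lam) (hμ : 0 < μ) :
    ∃ p, pathCost path c f p = lam := by
  obtain ⟨p, -, hp⟩ := Finset.exists_lt_of_sum_lt (s := Finset.univ) (f := fun _ : P => (0 : ℝ))
    (g := f) (by simpa [h.1.2] using hμ)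
  exact ⟨p, h.2.1 p hp⟩

lemma nonneg (h : IsWardrop path c μ f lam) (hμ : 0 < μ) (hc_nonneg : ∀ e x, 0 ≤ c e x) :
    0 ≤ lam := by
  obtain ⟨p, rfl⟩ := h.exists_pathCost_eq hμ
  exact Finset.sum_nonneg fun e _ => hc_nonneg e _

lemma le_sum_cost [Fintype E] [Nonempty P] (h : IsWardrop path c μ f lam)
    (hc_nonneg : ∀ e x, 0 ≤ c e x) (hc_mono : ∀ e, Monotone (c e)) (hμν : μ ≤ ν) :
    lam ≤ ∑ e, c e ν := by
  obtain ⟨p⟩ := ‹Nonempty P›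
  calc lam ≤ ∑ e ∈ path p, c e (edgeLoad path f e) := h.2.2 p
    _ ≤ ∑ e ∈ path p, c e ν :=
      Finset.sum_le_sum fun e _ => hc_mono e ((edgeLoad_le path h.1 e).trans hμν)
    _ ≤ ∑ e, c e ν :=
      Finset.sum_le_sum_of_subset_of_nonneg (Finset.subset_univ _) fun e _ _ => hc_nonneg e ν

/-- Monotonicity estimate between equilibria at two demands, on each single edge. -/
lemma edge_mul_le [Fintype E] (hc_mono : ∀ e, Monotone (c e)) (hf : IsWardrop path c μ f lam)
    (hg : IsWardrop path c ν g lam') (e : E) :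
    (edgeLoad path f e - edgeLoad path g e) *
      (c e (edgeLoad path f e) - c e (edgeLoad path g e)) ≤ (μ - ν) * (lam - lam') := by
  have hsum : ∑ e, (edgeLoad path f e - edgeLoad path g e) *
      (c e (edgeLoad path f e) - c e (edgeLoad path g e)) ≤ (μ - ν) * (lam - lam') := by
    have hff := hf.sum_mul_pathCost_self
    have hgg := hg.sum_mul_pathCost_self
    have hfg := hf.mul_le_sum_mul_pathCost hg.1
    have hgf := hg.mul_le_sum_mul_pathCost hf.1
    rw [sum_mul_pathCost] at hff hgg hfg hgf
    simp only [sub_mul, mul_sub, Finset.sum_sub_distrib]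
    linarith
  refine le_trans (Finset.single_le_sum (f := fun e => (edgeLoad path f e - edgeLoad path g e) *
    (c e (edgeLoad path f e) - c e (edgeLoad path g e))) (fun e _ => ?_) (Finset.mem_univ e)) hsum
  rcases le_total (edgeLoad path f e) (edgeLoad path g e) with hle | hle
  · exact mul_nonneg_of_nonpos_of_nonpos (sub_nonpos.2 hle) (sub_nonpos.2 (hc_mono e hle))
  · exact mul_nonneg (sub_nonneg.2 hle) (sub_nonneg.2 (hc_mono e hle))

end IsWardrop

/-- If `(x - y) * (c x - c y)` tends to zero for a monotone `c` continuous at `y`, then `c x`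
tends to `c y`. -/
lemma Monotone.tendsto_of_mul_sub_tendsto_zero {ι : Type*} {l : Filter ι} {c : ℝ → ℝ}
    (hc : Monotone c) {y : ℝ} (hcont : ContinuousAt c y) {x : ι → ℝ}
    (h : ∀ δ > 0, ∀ᶠ i in l, (x i - y) * (c (x i) - c y) < δ) :
    Filter.Tendsto (fun i => c (x i)) l (nhds (c y)) := by
  rw [Metric.tendsto_nhds]
  intro δ hδ
  obtain ⟨η, hη, hcη⟩ := Metric.continuousAt_iff.1 hcont δ hδ
  filter_upwards [h (η * δ) (mul_pos hη hδ)] with i hi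
  by_contra hcon
  have hx : η ≤ |x i - y| := not_lt.1 fun hlt => hcon (hcη hlt)
  have hcx : δ ≤ |c (x i) - c y| := not_lt.1 hcon
  have habs : (x i - y) * (c (x i) - c y) = |x i - y| * |c (x i) - c y| := by
    rcases le_total (x i) y with hle | hle
    · rw [abs_of_nonpos (sub_nonpos.2 hle), abs_of_nonpos (sub_nonpos.2 (hc hle)), neg_mul_neg]
    · rw [abs_of_nonneg (sub_nonneg.2 hle), abs_of_nonneg (sub_nonneg.2 (hc hle))]
  rw [habs] at hi
  exact hi.not_ge (mul_le_mul hx hcx hδ.le (abs_nonneg _))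

/-- Equilibrium edge costs are continuous in the demand on `(0, ∞)`. -/
lemma tendsto_equilibrium_edge_cost [Fintype E] [DecidableEq E] [Fintype P] [Nonempty P]
    {path : P → Finset E} {c : E → ℝ → ℝ} (hc_cont : ∀ e, Continuous (c e))
    (hc_nonneg : ∀ e x, 0 ≤ c e x) (hc_mono : ∀ e, Monotone (c e))
    {feq : ℝ → P → ℝ} {lamf : ℝ → ℝ}
    (hfeq : ∀ μ : ℝ, 0 < μ → IsWardrop path c μ (feq μ) (lamf μ))
    {μ₀ : ℝ} (hμ₀ : 0 < μ₀) (e : E) :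
    Filter.Tendsto (fun μ => c e (edgeLoad path (feq μ) e)) (nhds μ₀)
      (nhds (c e (edgeLoad path (feq μ₀) e))) := by
  refine (hc_mono e).tendsto_of_mul_sub_tendsto_zero (hc_cont e).continuousAt fun δ hδ => ?_
  set M := ∑ e, c e (μ₀ + 1)
  have hM0 : 0 ≤ M := Finset.sum_nonneg fun e _ => hc_nonneg e _
  have hlim : Filter.Tendsto (fun μ => |μ - μ₀| * M) (nhds μ₀) (nhds 0) := by
    have hcont : Continuous fun μ : ℝ => |μ - μ₀| * M := by fun_prop
    simpa using hcont.tendsto μ₀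
  filter_upwards [hlim.eventually_lt_const hδ, lt_mem_nhds hμ₀,
    gt_mem_nhds (lt_add_one μ₀)] with μ hsmall hμ hμ1
  have hW := hfeq μ hμ
  have hW₀ := hfeq μ₀ hμ₀
  have hlam : |lamf μ - lamf μ₀| ≤ M := abs_sub_le_of_nonneg_of_le (hW.nonneg hμ hc_nonneg)
    (hW.le_sum_cost hc_nonneg hc_mono hμ1.le) (hW₀.nonneg hμ₀ hc_nonneg)
    (hW₀.le_sum_cost hc_nonneg hc_mono (lt_add_one μ₀).le)
  calc _ ≤ (μ - μ₀) * (lamf μ - lamf μ₀) := hW.edge_mul_le hc_mono hW₀ e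
    _ ≤ |μ - μ₀| * |lamf μ - lamf μ₀| := (le_abs_self _).trans (abs_mul _ _).le
    _ ≤ |μ - μ₀| * M := mul_le_mul_of_nonneg_left hlam (abs_nonneg _)
    _ < δ := hsmall

/-- edges inactive at a demand `μ₀ > 0` remain inactive at all nearby
demands: `Ẽ(μ) ⊆ Ẽ(μ₀)` for all `μ` in a punctured neighborhood of `μ₀` inside `(0,∞)`. -/
theorem active_network_upper_semicontinuous
    [Fintype E] [DecidableEq E] [Nonempty E] [Fintype P] [Nonempty P]
    (path : P → Finset E) (hpath : ∀ p, (path p).Nonempty)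
    (c : E → ℝ → ℝ)
    (hc_cont : ∀ e, Continuous (c e))
    (hc_nonneg : ∀ e x, 0 ≤ c e x)
    (hc_mono : ∀ e, Monotone (c e))
    (feq : ℝ → P → ℝ) (lamf : ℝ → ℝ)
    (hfeq : ∀ μ : ℝ, 0 < μ → IsWardrop path c μ (feq μ) (lamf μ)) :
    ∀ μ₀ : ℝ, 0 < μ₀ → ∃ ε > 0, ∀ μ ∈ Set.Ioo (μ₀ - ε) (μ₀ + ε), 0 < μ →
      activeNet path c (feq μ) (lamf μ) ⊆ activeNet path c (feq μ₀) (lamf μ₀) := by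
  intro μ₀ hμ₀
  obtain ⟨q, hq⟩ := (hfeq μ₀ hμ₀).exists_pathCost_eq hμ₀
  have hcost (p : P) : Filter.Tendsto (fun μ => pathCost path c (feq μ) p) (nhds μ₀)
      (nhds (pathCost path c (feq μ₀) p)) :=
    tendsto_finsetSum _ fun e _ =>
      tendsto_equilibrium_edge_cost hc_cont hc_nonneg hc_mono hfeq hμ₀ e
  have hev : ∀ᶠ μ in nhds μ₀, ∀ p, pathCost path c (feq μ₀) p ≠ lamf μ₀ →
      pathCost path c (feq μ) q < pathCost path c (feq μ) p := by
    refine Filter.eventually_all.2 fun p => ?_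
    by_cases hp : pathCost path c (feq μ₀) p = lamf μ₀
    · exact Filter.Eventually.of_forall fun μ hne => absurd hp hne
    · have hlt : pathCost path c (feq μ₀) q < pathCost path c (feq μ₀) p :=
        hq ▸ lt_of_le_of_ne ((hfeq μ₀ hμ₀).2.2 p) (Ne.symm hp)
      filter_upwards [(hcost q).eventually_lt (hcost p) hlt] with μ hμ _ using hμ
  obtain ⟨ε, hε, hball⟩ := Metric.eventually_nhds_iff_ball.1 hev
  refine ⟨ε, hε, fun μ hμ hpos e ⟨p, hp, hep⟩ => ⟨p, ?_, hep⟩⟩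
  by_contra hne
  have hlt := hball μ (by rwa [Real.ball_eq_Ioo]) p hne
  exact (hp ▸ hlt).not_ge ((hfeq μ hpos).2.2 q)
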